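/- arXiv:2106.04855 — 4 statements merged into one kernel-verified Lean document; each statement's English description precedes it below -/
import Mathlib

section
/- Let R be a commutative Noetherian ring, let A be an m×n matrix with entries in R, and let t be a natural number with 1 ≤ t. If the ideal I_t(A) of t-minors of A is a proper ideal of R, then the height of I_t(A) is at most (m−t+1)(n−t+1). -/
/-- The ideal of `t`-minors of a matrix `A`, generated by the determinants of
`t × t` submatrices selected by strictly monotone choices of rows and columns. -/
def minorsIdeal {R : Type*} [CommRing R] {m n : ℕ}
    (A : Matrix (Fin m) (Fin n) R) (t : ℕ) : Ideal R :=
  Ideal.span {x | ∃ (i : Fin t → Fin m) (j : Fin t → Fin n),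
    StrictMono i ∧ StrictMono j ∧ x = (A.submatrix i j).det}

/-- The height of an ideal: the infimum of the heights of the prime ideals
containing it. -/
noncomputable def idealHeight {R : Type*} [CommRing R] (I : Ideal R) : ℕ∞ :=
  ⨅ (P : {J : Ideal R // J.IsPrime}) (_ : I ≤ P.1), Order.height P

open Polynomial

/-- The rank of a block diagonal matrix over a field is the sum of the ranks of its blocks. -/
theorem Matrix.rank_fromBlocks_zero_zero {K l m n o : Type*} [Field K] [Fintype l] [Fintype m]
    [Fintype n] [Fintype o] (A : Matrix l m K) (D : Matrix n o K) :
    (Matrix.fromBlocks A 0 0 D).rank = A.rank + D.rank := by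
  have h : (Matrix.fromBlocks A 0 0 D).mulVecLin =
      (LinearEquiv.sumArrowLequivProdArrow l n K K).symm.toLinearMap ∘ₗ
        (A.mulVecLin.prodMap D.mulVecLin ∘ₗ
          (LinearEquiv.sumArrowLequivProdArrow m o K K).toLinearMap) := by
    refine LinearMap.ext fun v ↦ funext fun i ↦ ?_
    rcases i with i | i
    all_goals
      simp [Matrix.fromBlocks_mulVec]
      rfl
  have hprod (p : Submodule K (l → K)) (q : Submodule K (n → K)) :
      Module.finrank K (p.prod q) = Module.finrank K p + Module.finrank K q := by
    have hinj : Function.Injective (p.subtype.prodMap q.subtype) :=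
      Function.Injective.prodMap p.injective_subtype q.injective_subtype
    rw [← Module.finrank_prod, ← LinearMap.finrank_range_of_inj hinj, LinearMap.range_prodMap,
      Submodule.range_subtype, Submodule.range_subtype]
  rw [Matrix.rank, h, LinearMap.range_comp, LinearEquiv.finrank_map_eq,
    LinearMap.range_comp_of_range_eq_top _ (LinearEquiv.range _), LinearMap.range_prodMap, hprod]
  rfl

/-- The matrix obtained from `A` by fraction-free elimination of the row and the column of the
entry `A i₀ j₀`. -/
def Matrix.pivot {R : Type*} [CommRing R] {m n : ℕ} (A : Matrix (Fin (m + 1)) (Fin (n + 1)) R)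
    (i₀ : Fin (m + 1)) (j₀ : Fin (n + 1)) : Matrix (Fin m) (Fin n) R :=
  .of fun i j ↦ A i₀ j₀ * A (i₀.succAbove i) (j₀.succAbove j) -
    A (i₀.succAbove i) j₀ * A i₀ (j₀.succAbove j)

theorem Matrix.map_pivot {R S : Type*} [CommRing R] [CommRing S] {m n : ℕ} (f : R →+* S)
    (A : Matrix (Fin (m + 1)) (Fin (n + 1)) R) (i₀ : Fin (m + 1)) (j₀ : Fin (n + 1)) :
    (A.pivot i₀ j₀).map f = (A.map f).pivot i₀ j₀ := by
  ext i j
  simp [Matrix.pivot]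

theorem Matrix.rank_eq_one_add_rank_pivot {K : Type*} [Field K] {m n : ℕ}
    (A : Matrix (Fin (m + 1)) (Fin (n + 1)) K) {i₀ : Fin (m + 1)} {j₀ : Fin (n + 1)}
    (h : A i₀ j₀ ≠ 0) : A.rank = 1 + (A.pivot i₀ j₀).rank := by
  let e {k : ℕ} (x : Fin (k + 1)) : Unit ⊕ Fin k ≃ Fin (k + 1) :=
    (Equiv.sumComm _ _).trans
      ((Equiv.optionEquivSumPUnit _).symm.trans (finSuccEquiv' x).symm)
  let a : Matrix Unit Unit K := .of fun _ _ ↦ A i₀ j₀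
  let b : Matrix Unit (Fin n) K := .of fun _ j ↦ A i₀ (j₀.succAbove j)
  let c : Matrix (Fin m) Unit K := .of fun i _ ↦ A (i₀.succAbove i) j₀
  let D : Matrix (Fin m) (Fin n) K := .of fun i j ↦ A (i₀.succAbove i) (j₀.succAbove j)
  have hA : A.submatrix (e i₀) (e j₀) = Matrix.fromBlocks a b c D := by
    ext i j
    rcases i with i | i <;> rcases j with j | j <;> rfl
  have hdet : a.det ≠ 0 := by simpa [a] using h
  let _ : Invertible a := Matrix.invertibleOfIsUnitDet a (isUnit_iff_ne_zero.mpr hdet)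
  have hS : A.pivot i₀ j₀ = A i₀ j₀ • (D - c * ⅟a * b) := by
    have hinv : ⅟a () () = (A i₀ j₀)⁻¹ := by
      have := congrFun (congrFun (mul_invOf_self a) ()) ()
      simp only [Matrix.mul_apply, Finset.univ_unique, Finset.sum_singleton,
        Matrix.one_apply_eq] at this
      exact eq_inv_of_mul_eq_one_right this
    ext i j
    simp only [Matrix.pivot, Matrix.of_apply, Matrix.smul_apply, Matrix.sub_apply,
      Matrix.mul_apply, Finset.univ_unique, PUnit.default_eq_unit, Finset.sum_singleton, hinv,
      smul_eq_mul, b, c, D]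
    field_simp
  rw [← Matrix.rank_submatrix A (e i₀) (e j₀), hA, Matrix.fromBlocks_eq_of_invertible₁₁,
    Matrix.rank_mul_eq_left_of_isUnit_det _ _ (by simp),
    Matrix.rank_mul_eq_right_of_isUnit_det _ _ (by simp), Matrix.rank_fromBlocks_zero_zero, hS,
    Matrix.rank_smul_of_mem_nonZeroDivisors _ (mem_nonZeroDivisors_of_ne_zero h),
    Matrix.rank_of_det_ne_zero hdet]
  simp

/-- A finite family spanning a space of dimension at least `t` has a linearly independent
subfamily of length `t`, indexed in increasing order. -/
theorem exists_strictMono_linearIndependent {K V : Type*} [Field K] [AddCommGroup V] [Module K V]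
    {m t : ℕ} (v : Fin m → V) (h : t ≤ Module.finrank K (Submodule.span K (Set.range v))) :
    ∃ i : Fin t → Fin m, StrictMono i ∧ LinearIndependent K (v ∘ i) := by
  obtain ⟨κ, a, ha, hspan, hli⟩ := exists_linearIndependent' K v
  have := Finite.of_injective a ha
  have := Fintype.ofFinite κ
  rw [← hspan, finrank_span_eq_card hli, ← Finset.card_univ,
    ← Finset.card_map ⟨a, ha⟩] at h
  obtain ⟨s, hs, hcard⟩ := Finset.exists_subset_card_eq h
  have hmem (x : Fin t) : ∃ k, a k = s.orderEmbOfFin hcard x := by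
    simpa using hs (s.orderEmbOfFin_mem hcard x)
  choose g hg using hmem
  refine ⟨s.orderEmbOfFin hcard, (s.orderEmbOfFin hcard).strictMono, ?_⟩
  have hg' : v ∘ s.orderEmbOfFin hcard = (v ∘ a) ∘ g := by
    ext x
    simp [hg]
  rw [hg']
  refine hli.comp g fun x y hxy ↦ (s.orderEmbOfFin hcard).injective ?_
  rw [← hg, ← hg, hxy]

/-- The `t`-minors of a matrix vanish under a map to a field if and only if the image matrix has
rank less than `t`. -/
theorem minorsIdeal_le_ker_iff {R K : Type*} [CommRing R] [Field K] (f : R →+* K) {m n : ℕ}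
    (A : Matrix (Fin m) (Fin n) R) (t : ℕ) :
    minorsIdeal A t ≤ RingHom.ker f ↔ (A.map f).rank < t := by
  constructor
  · intro h
    by_contra! hr
    rw [Matrix.rank_eq_finrank_span_row] at hr
    obtain ⟨i, hi, hli⟩ := exists_strictMono_linearIndependent _ hr
    have hrank : t ≤ ((A.map f).submatrix i id).rank := by
      rw [LinearIndependent.rank_matrix (M := (A.map f).submatrix i id) hli, Fintype.card_fin]
    rw [Matrix.rank_eq_finrank_span_cols] at hrank
    obtain ⟨j, hj, hlj⟩ := exists_strictMono_linearIndependent _ hrank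
    have hu : IsUnit ((A.map f).submatrix i j) :=
      Matrix.linearIndependent_cols_iff_isUnit.mp hlj
    have hmem : f (A.submatrix i j).det = 0 :=
      h (Ideal.subset_span ⟨i, j, hi, hj, rfl⟩)
    rw [RingHom.map_det] at hmem
    exact ((Matrix.isUnit_iff_isUnit_det _).mp hu).ne_zero hmem
  · rintro h
    refine Ideal.span_le.mpr ?_
    rintro _ ⟨i, j, -, -, rfl⟩
    by_contra hne
    have hdet : ((A.map f).submatrix i j).det ≠ 0 := by
      rwa [SetLike.mem_coe, RingHom.mem_ker, RingHom.map_det] at hne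
    have := Matrix.rank_submatrix_le (A.map f) i j
    rw [Matrix.rank_of_det_ne_zero hdet, Fintype.card_fin] at this
    omega

/-- Away from the vanishing locus of a pivot, the `(t + 1)`-minors of a matrix and the
`t`-minors of the matrix obtained by eliminating with this pivot define the same locus. -/
theorem minorsIdeal_succ_le_iff_pivot {R : Type*} [CommRing R] {m n : ℕ}
    (A : Matrix (Fin (m + 1)) (Fin (n + 1)) R) (t : ℕ) {i₀ : Fin (m + 1)} {j₀ : Fin (n + 1)}
    {P : Ideal R} [P.IsPrime] (h : A i₀ j₀ ∉ P) :
    minorsIdeal A (t + 1) ≤ P ↔ minorsIdeal (A.pivot i₀ j₀) t ≤ P := by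
  have h0 : (A.map (algebraMap R P.ResidueField)) i₀ j₀ ≠ 0 := by
    simpa using h
  rw [← P.ker_algebraMap_residueField, minorsIdeal_le_ker_iff, minorsIdeal_le_ker_iff,
    Matrix.map_pivot, Matrix.rank_eq_one_add_rank_pivot _ h0]
  omega

theorem mem_minimalPrimes_minorsIdeal_pivot {R : Type*} [CommRing R] {m n : ℕ}
    {A : Matrix (Fin (m + 1)) (Fin (n + 1)) R} {t : ℕ} {i₀ : Fin (m + 1)} {j₀ : Fin (n + 1)}
    {P : Ideal R} (hP : P ∈ (minorsIdeal A (t + 1)).minimalPrimes) (h : A i₀ j₀ ∉ P) :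
    P ∈ (minorsIdeal (A.pivot i₀ j₀) t).minimalPrimes := by
  have := hP.isPrime
  refine ⟨⟨this, (minorsIdeal_succ_le_iff_pivot A t h).mp hP.1.2⟩, fun Q ⟨hQ, hle⟩ hQP ↦ ?_⟩
  exact hP.2 ⟨hQ, (minorsIdeal_succ_le_iff_pivot A t fun hm ↦ h (hQP hm)).mpr hle⟩ hQP

theorem minorsIdeal_map {R S : Type*} [CommRing R] [CommRing S] (f : R →+* S) {m n : ℕ}
    (A : Matrix (Fin m) (Fin n) R) (t : ℕ) :
    minorsIdeal (A.map f) t = (minorsIdeal A t).map f := by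
  rw [minorsIdeal, minorsIdeal, Ideal.map_span]
  congr 1
  ext x
  constructor
  · rintro ⟨i, j, hi, hj, rfl⟩
    exact ⟨_, ⟨i, j, hi, hj, rfl⟩, RingHom.map_det _ _⟩
  · rintro ⟨_, ⟨i, j, hi, hj, rfl⟩, rfl⟩
    exact ⟨i, j, hi, hj, RingHom.map_det _ _⟩

/-- The height of a prime does not drop under extension to the polynomial ring. -/
theorem Ideal.height_le_height_map_C {R : Type*} [CommRing R] (P : Ideal R) [hP : P.IsPrime] :
    P.height ≤ (P.map (C : R →+* R[X])).height := by
  let f : PrimeSpectrum R → PrimeSpectrum R[X] := fun Q ↦ ⟨Q.asIdeal.map C, inferInstance⟩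
  have hcomap (Q : Ideal R) : (Q.map (C : R →+* R[X])).comap C = Q := by
    ext x
    rw [Ideal.mem_comap, Ideal.mem_map_C_iff]
    refine ⟨fun h ↦ by simpa using h 0, fun h k ↦ ?_⟩
    rw [coeff_C]
    split_ifs
    exacts [h, Q.zero_mem]
  have hf : StrictMono f := by
    refine Monotone.strictMono_of_injective (fun Q Q' h ↦ Ideal.map_mono h) fun Q Q' h ↦ ?_
    apply PrimeSpectrum.ext
    rw [← hcomap Q.asIdeal, ← hcomap Q'.asIdeal]
    exact congrArg (fun p ↦ p.asIdeal.comap C) h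
  have := Order.height_le_height_apply_of_strictMono f hf ⟨P, hP⟩
  rwa [← PrimeSpectrum.height_eq_orderHeight, ← PrimeSpectrum.height_eq_orderHeight] at this

/-- Adding the variable `X` to one entry of a matrix. -/
noncomputable def Matrix.addX {R : Type*} [CommRing R] {m n : ℕ} (A : Matrix (Fin m) (Fin n) R)
    (i₀ : Fin m) (j₀ : Fin n) : Matrix (Fin m) (Fin n) R[X] :=
  A.map C + Matrix.single i₀ j₀ X

/-- If `P` contains all entries of `A` and is a minimal prime over the ideal of `t`-minors, with
`2 ≤ t`, then its extension to the polynomial ring is a minimal prime over the `t`-minors of the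
matrix with the variable added to one entry. -/
theorem map_C_mem_minimalPrimes_minorsIdeal_addX {R : Type*} [CommRing R] [IsNoetherianRing R]
    {m n : ℕ} {A : Matrix (Fin m) (Fin n) R} {t : ℕ} (ht : 2 ≤ t) {P : Ideal R}
    (hP : P ∈ (minorsIdeal A t).minimalPrimes) (hA : ∀ i j, A i j ∈ P) (i₀ : Fin m) (j₀ : Fin n) :
    P.map C ∈ (minorsIdeal (A.addX i₀ j₀) t).minimalPrimes := by
  have := hP.isPrime
  let ε : R[X] →+* R := evalRingHom 0
  let M : Ideal R[X] := P.comap ε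
  have hεC (x : R) : ε (C x) = x := by simp [ε]
  have hXM : (X : R[X]) ∈ M := by simp [M, ε]
  have hCM : P.map C ≤ M := Ideal.map_le_iff_le_comap.mpr fun x hx ↦ by simpa [M, ε] using hx
  have hXP : (X : R[X]) ∉ P.map C := fun h ↦ by
    have := Ideal.mem_map_C_iff.mp h 1
    rw [coeff_X_one] at this
    exact (Ideal.ne_top_iff_one P).mp hP.isPrime.ne_top this
  let s : Set R[X] := C '' {x | ∃ (i : Fin t → Fin m) (j : Fin t → Fin n),
    StrictMono i ∧ StrictMono j ∧ x = (A.submatrix i j).det}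
  have hs : Ideal.span s = (minorsIdeal A t).map C := (Ideal.map_span _ _).symm
  have hmapε : (A.addX i₀ j₀).map ε = A := by
    ext i j
    by_cases h : i₀ = i ∧ j₀ = j
    · simp [Matrix.addX, Matrix.single, h, ε]
    · simp [Matrix.addX, Matrix.single, h, ε]
  refine Ideal.mem_minimalPrimes_span_of_mem_minimalPrimes_span_insert (p := M)
    (lt_of_le_of_ne hCM fun h ↦ hXP (h ▸ hXM)) X s ?_ _ ?_ ?_
  · refine ⟨⟨inferInstance, ?_⟩, fun Q ⟨hQ, hle⟩ hQM ↦ ?_⟩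
    · rw [Ideal.span_insert, sup_le_iff, Ideal.span_singleton_le_iff_mem, hs]
      exact ⟨hXM, (Ideal.map_mono hP.1.2).trans hCM⟩
    · rw [Ideal.span_insert, sup_le_iff, Ideal.span_singleton_le_iff_mem, hs,
        Ideal.map_le_iff_le_comap] at hle
      have hPQ : P ≤ Q.comap C := hP.2 ⟨inferInstance, hle.2⟩ fun x hx ↦ by
        simpa [M, hεC] using hQM hx
      intro p hp
      rw [← divX_mul_X_add p]
      refine Q.add_mem (Q.mul_mem_left _ hle.1) (hPQ ?_)
      simpa [M, ε, coeff_zero_eq_eval_zero] using hp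
  · rintro x hx
    have hle : minorsIdeal (A.addX i₀ j₀) t ≤ P.map C := by
      rw [← (P.map C).ker_algebraMap_residueField, minorsIdeal_le_ker_iff]
      have hmap : (A.addX i₀ j₀).map (algebraMap R[X] (P.map C).ResidueField) =
          Matrix.vecMulVec (Pi.single i₀ (algebraMap R[X] (P.map C).ResidueField X))
            (Pi.single j₀ 1) := by
        have h0 (i j) : algebraMap R[X] (P.map C).ResidueField (C (A i j)) = 0 :=
          Ideal.algebraMap_residueField_eq_zero.mpr (Ideal.mem_map_of_mem C (hA i j))
        ext i j
        simp only [Matrix.addX, Matrix.map_apply, Matrix.add_apply, map_add, h0, zero_add,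
          Matrix.vecMulVec_apply, Pi.single_apply, Matrix.single, Matrix.of_apply,
          eq_comm (a := i), eq_comm (a := j), ite_and]
        split_ifs <;> simp
      rw [hmap]
      exact (Matrix.rank_vecMulVec_le _ _).trans_lt ht
    exact hle (Ideal.subset_span hx)
  · refine Set.Subset.trans ?_ Ideal.le_radical
    rintro _ ⟨d, hd, rfl⟩
    have hd' : d ∈ (minorsIdeal (A.addX i₀ j₀) t).map ε := by
      rw [← minorsIdeal_map, hmapε]
      exact Ideal.subset_span hd
    obtain ⟨p, hp, rfl⟩ :=
      (Ideal.mem_map_iff_of_surjective ε fun x ↦ ⟨C x, hεC x⟩).mp hd'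
    rw [Ideal.span_insert]
    have hp' : C (ε p) = p - divX p * X := by
      rw [eq_sub_iff_add_eq']
      simpa [ε, coeff_zero_eq_eval_zero] using divX_mul_X_add p
    rw [hp']
    exact Ideal.sub_mem _ (Ideal.mem_sup_right hp)
      (Ideal.mem_sup_left (Ideal.mul_mem_left _ _ (Ideal.mem_span_singleton_self X)))

/-- The height bound for the minimal primes over the ideal of entries of a matrix. -/
theorem height_le_of_mem_minimalPrimes_minorsIdeal_one {R : Type*} [CommRing R]
    [IsNoetherianRing R] {m n : ℕ} {A : Matrix (Fin m) (Fin n) R} {P : Ideal R}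
    (hP : P ∈ (minorsIdeal A 1).minimalPrimes) : P.height ≤ (m * n : ℕ) := by
  let g : Fin m × Fin n → R := fun p ↦ A p.1 p.2
  have h : minorsIdeal A 1 = Ideal.span (Set.range g) := by
    rw [minorsIdeal]
    congr 1
    ext x
    constructor
    · rintro ⟨i, j, -, -, rfl⟩
      exact ⟨(i 0, j 0), by simp [g]⟩
    · rintro ⟨⟨i, j⟩, rfl⟩
      exact ⟨fun _ ↦ i, fun _ ↦ j, Subsingleton.strictMono _, Subsingleton.strictMono _,
        by simp [g]⟩
  rw [h] at hP
  refine (Ideal.height_le_card_of_mem_minimalPrimes_span (Set.finite_range g) hP).trans ?_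
  rw [Nat.cast_le, ← Set.image_univ]
  refine (Set.ncard_image_le Set.finite_univ).trans ?_
  simp [Set.ncard_univ]

/-- The height bound for all minimal primes over a determinantal ideal. -/
theorem height_le_of_mem_minimalPrimes_minorsIdeal {R : Type*} [CommRing R] [IsNoetherianRing R]
    {m n : ℕ} (A : Matrix (Fin m) (Fin n) R) (t : ℕ) {P : Ideal R}
    (hP : P ∈ (minorsIdeal A (t + 1)).minimalPrimes) :
    P.height ≤ ((m - (t + 1) + 1) * (n - (t + 1) + 1) : ℕ) := by
  induction t generalizing R m n with
  | zero =>
    refine (height_le_of_mem_minimalPrimes_minorsIdeal_one hP).trans ?_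
    exact Nat.cast_le.mpr (Nat.mul_le_mul (by omega) (by omega))
  | succ t ih =>
    have := hP.isPrime
    have key {S : Type _} [CommRing S] [IsNoetherianRing S] (B : Matrix (Fin m) (Fin n) S)
        {Q : Ideal S} (hQ : Q ∈ (minorsIdeal B (t + 1 + 1)).minimalPrimes) (i : Fin m) (j : Fin n)
        (hij : B i j ∉ Q) : Q.height ≤ ((m - (t + 1 + 1) + 1) * (n - (t + 1 + 1) + 1) : ℕ) := by
      obtain _ | m := m
      · exact i.elim0
      obtain _ | n := n
      · exact j.elim0
      simpa only [Nat.add_sub_add_right] using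
        ih (B.pivot i j) (mem_minimalPrimes_minorsIdeal_pivot hQ hij)
    by_cases hA : ∃ i j, A i j ∉ P
    · obtain ⟨i, j, hij⟩ := hA
      exact key A hP i j hij
    push Not at hA
    by_cases hmn : Nonempty (Fin m × Fin n)
    · obtain ⟨i, j⟩ := hmn
      refine P.height_le_height_map_C.trans (key (A.addX i j)
        (map_C_mem_minimalPrimes_minorsIdeal_addX (by omega) hP hA i j) i j fun h ↦ ?_)
      have h1 := Ideal.mem_map_C_iff.mp h 1
      simp [Matrix.addX] at h1
      exact (Ideal.ne_top_iff_one P).mp hP.isPrime.ne_top h1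
    · have hbot : minorsIdeal A (t + 1 + 1) = ⊥ := by
        refine Ideal.span_eq_bot.mpr ?_
        rintro _ ⟨i, j, -, -, rfl⟩
        exact (hmn ⟨i 0, j 0⟩).elim
      rw [hbot] at hP
      rw [Ideal.height_eq_zero_iff.mpr hP]
      exact bot_le

/-- Eagon–Northcott bound: if the ideal of `t`-minors of an `m × n` matrix over a
Noetherian commutative ring is proper, then its height is at most
`(m - t + 1) * (n - t + 1)`. -/
theorem height_minorsIdeal_le {R : Type*} [CommRing R] [IsNoetherianRing R]
    {m n : ℕ} (A : Matrix (Fin m) (Fin n) R) (t : ℕ) (ht : 1 ≤ t)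
    (hI : minorsIdeal A t ≠ ⊤) :
    idealHeight (minorsIdeal A t) ≤ ((m - t + 1) * (n - t + 1) : ℕ) := by
  obtain ⟨P, hP⟩ := Ideal.nonempty_minimalPrimes hI
  obtain ⟨t, rfl⟩ := Nat.exists_eq_add_of_le' ht
  let e : {J : Ideal R // J.IsPrime} ≃o PrimeSpectrum R :=
    ⟨⟨fun J ↦ ⟨J.1, J.2⟩, fun Q ↦ ⟨Q.asIdeal, Q.isPrime⟩, fun _ ↦ rfl, fun _ ↦ rfl⟩, Iff.rfl⟩
  refine (iInf₂_le ⟨P, hP.isPrime⟩ hP.1.2).trans ?_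
  rw [← Order.height_orderIso e, ← PrimeSpectrum.height_eq_orderHeight]
  exact height_le_of_mem_minimalPrimes_minorsIdeal A t hP
end

section
/- Let R be a commutative Noetherian ring and let A be a symmetric n×n matrix over R (that is, Aᵀ = A). Let s be a natural number with 1 ≤ s ≤ n. If the ideal I_s(A) of s-minors of A is a proper ideal of R, then the height of I_s(A) is at most (n−s+2)(n−s+1)/2. -/
open Polynomial

theorem Submodule.finrank_prod {K V W : Type*} [Field K]
    [AddCommGroup V] [Module K V] [Module.Finite K V]
    [AddCommGroup W] [Module K W] [Module.Finite K W] (p : Submodule K V) (q : Submodule K W) :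
    Module.finrank K (p.prod q) = Module.finrank K p + Module.finrank K q := by
  have h : (p.subtype.prodMap q.subtype).range = p.prod q := by
    rw [LinearMap.range_prodMap, p.range_subtype, q.range_subtype]
  rw [← h, LinearMap.finrank_range_of_inj
    (p.subtype_injective.prodMap q.subtype_injective), Module.finrank_prod]

namespace Matrix

section Field

variable {K : Type*} [Field K]

theorem exists_linearIndependent_col_comp {m n : Type*} [Finite m] [Fintype n]
    (A : Matrix m n K) {s : ℕ} (hs : s ≤ A.rank) :
    ∃ j : Fin s → n, LinearIndependent K (A.col ∘ j) := by
  rw [rank_eq_finrank_span_cols] at hs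
  obtain ⟨f, hf, -, hli⟩ := Submodule.exists_fun_fin_finrank_span_eq K (Set.range A.col)
  choose g hg using hf
  refine ⟨g ∘ Fin.castLE hs, ?_⟩
  have : A.col ∘ g ∘ Fin.castLE hs = f ∘ Fin.castLE hs := by
    ext1 i
    exact hg _
  rw [this]
  exact hli.comp _ (Fin.castLE_injective hs)

theorem exists_det_submatrix_ne_zero {m n : Type*} [Fintype m] [Fintype n]
    (A : Matrix m n K) {s : ℕ} (hs : s ≤ A.rank) :
    ∃ (i : Fin s → m) (j : Fin s → n), (A.submatrix i j).det ≠ 0 := by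
  obtain ⟨j, hj⟩ := A.exists_linearIndependent_col_comp hs
  have hrank : s ≤ (A.submatrix id j)ᵀ.rank := by
    have h : LinearIndependent K (A.submatrix id j)ᵀ.row := hj
    rw [h.rank_matrix, Fintype.card_fin]
  obtain ⟨i, hi⟩ := (A.submatrix id j)ᵀ.exists_linearIndependent_col_comp hrank
  refine ⟨i, j, ?_⟩
  have h : LinearIndependent K (A.submatrix i j).row := hi
  exact ((isUnit_iff_isUnit_det _).mp (linearIndependent_rows_iff_isUnit.mp h)).ne_zero

theorem rank_lt_iff_det_submatrix_eq_zero {m n : Type*} [Fintype m] [Fintype n]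
    (A : Matrix m n K) (s : ℕ) :
    A.rank < s ↔ ∀ (i : Fin s → m) (j : Fin s → n), (A.submatrix i j).det = 0 := by
  refine ⟨fun h i j ↦ ?_, fun h ↦ ?_⟩
  · by_contra hdet
    have h1 := rank_of_det_ne_zero hdet
    have h2 := A.rank_submatrix_le i j
    rw [h1, Fintype.card_fin] at h2
    omega
  · by_contra! hs
    obtain ⟨i, j, hij⟩ := A.exists_det_submatrix_ne_zero hs
    exact hij (h i j)

theorem rank_fromBlocks_zero_zero_s3 {m n : Type*} [Fintype m] [Fintype n]
    (P : Matrix m m K) (S : Matrix n n K) :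
    (fromBlocks P 0 0 S).rank = P.rank + S.rank := by
  let e := LinearEquiv.sumArrowLequivProdArrow m n K K
  have h : (fromBlocks P 0 0 S).mulVecLin =
      e.symm.toLinearMap ∘ₗ (P.mulVecLin.prodMap S.mulVecLin) ∘ₗ e.toLinearMap := by
    ext v x
    rcases x with x | x <;> simp [e, fromBlocks_mulVec] <;> rfl
  rw [rank, h, LinearMap.range_comp, LinearEquiv.finrank_map_eq, LinearMap.range_comp,
    LinearEquiv.range, Submodule.map_top, LinearMap.range_prodMap,
    Submodule.finrank_prod, rank, rank]

theorem rank_fromBlocks_eq_add {m n : Type*} [Fintype m] [Fintype n] [DecidableEq m]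
    [DecidableEq n] (P : Matrix m m K) (B : Matrix m n K) (C : Matrix n m K) (D : Matrix n n K)
    (hP : P.det ≠ 0) :
    (fromBlocks P B C D).rank = Fintype.card m + (P.det • D - C * P.adjugate * B).rank := by
  have hu : IsUnit P.det := hP.isUnit
  let := P.invertibleOfIsUnitDet hu
  have hS : P.det • D - C * P.adjugate * B = P.det • (D - C * ⅟P * B) := by
    rw [invOf_eq_nonsing_inv, inv_def, smul_sub]
    simp [smul_smul, hP]
  rw [hS, rank_smul_of_mem_nonZeroDivisors _ (mem_nonZeroDivisors_of_ne_zero hP),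
    fromBlocks_eq_of_invertible₁₁ P, rank_mul_eq_left_of_isUnit_det,
    rank_mul_eq_right_of_isUnit_det, rank_fromBlocks_zero_zero_s3, rank_of_det_ne_zero hP]
  · simp
  · simp

end Field

section Minors

variable {R : Type*} [CommRing R]

/-- The ideal generated by the determinants of all `s × s` submatrices of `A`, with arbitrary (not
necessarily monotone or injective) selections of rows and columns. -/
def allMinorsIdeal {m n : Type*} (A : Matrix m n R) (s : ℕ) : Ideal R :=
  Ideal.span (Set.range fun ij : (Fin s → m) × (Fin s → n) ↦ (A.submatrix ij.1 ij.2).det)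

theorem allMinorsIdeal_le_iff {m n : Type*} (A : Matrix m n R) (s : ℕ) (I : Ideal R) :
    A.allMinorsIdeal s ≤ I ↔ ∀ (i : Fin s → m) (j : Fin s → n), (A.submatrix i j).det ∈ I := by
  simp [allMinorsIdeal, Ideal.span_le, Set.range_subset_iff]

theorem map_allMinorsIdeal {S : Type*} [CommRing S] (f : R →+* S) {m n : Type*}
    (A : Matrix m n R) (s : ℕ) :
    (A.allMinorsIdeal s).map f = (A.map f).allMinorsIdeal s := by
  rw [allMinorsIdeal, allMinorsIdeal, Ideal.map_span, ← Set.range_comp]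
  congr 2
  ext1 ij
  simp [RingHom.map_det, submatrix_map]

theorem allMinorsIdeal_le_iff_rank_lt {m n : Type*} [Fintype m] [Fintype n] (A : Matrix m n R)
    (s : ℕ) (q : Ideal R) [q.IsPrime] :
    A.allMinorsIdeal s ≤ q ↔ (A.map (algebraMap R q.ResidueField)).rank < s := by
  rw [allMinorsIdeal_le_iff, rank_lt_iff_det_submatrix_eq_zero]
  refine forall₂_congr fun i j ↦ ?_
  rw [submatrix_map, ← RingHom.mapMatrix_apply, ← RingHom.map_det,
    Ideal.algebraMap_residueField_eq_zero]

theorem minorsIdeal_eq_allMinorsIdeal {m n : ℕ} (A : Matrix (Fin m) (Fin n) R) (s : ℕ) :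
    minorsIdeal A s = A.allMinorsIdeal s := by
  apply le_antisymm
  · refine Ideal.span_le.mpr ?_
    rintro _ ⟨i, j, -, -, rfl⟩
    exact Ideal.subset_span ⟨(i, j), rfl⟩
  · refine (A.allMinorsIdeal_le_iff s _).mpr fun i j ↦ ?_
    by_cases hi : i.Injective
    · by_cases hj : j.Injective
      · have h : (A.submatrix (i ∘ Tuple.sort i) (j ∘ Tuple.sort j)).det ∈ minorsIdeal A s :=
          Ideal.subset_span ⟨_, _,
            (Tuple.monotone_sort i).strictMono_of_injective (hi.comp (Tuple.sort i).injective),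
            (Tuple.monotone_sort j).strictMono_of_injective (hj.comp (Tuple.sort j).injective),
            rfl⟩
        have hsort : (A.submatrix (i ∘ Tuple.sort i) (j ∘ Tuple.sort j)).det =
            (Tuple.sort i).sign * ((Tuple.sort j).sign * (A.submatrix i j).det) := by
          rw [← det_permute', ← det_permute]
          rfl
        rw [hsort] at h
        have hu (σ : Equiv.Perm (Fin s)) : IsUnit ((σ.sign : ℤ) : R) :=
          (Units.isUnit σ.sign).map (Int.castRingHom R)
        rwa [Ideal.unit_mul_mem_iff_mem _ (hu _), Ideal.unit_mul_mem_iff_mem _ (hu _)] at h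
      · obtain ⟨a, b, hab, hne⟩ := Function.not_injective_iff.mp hj
        rw [det_zero_of_column_eq hne (by simp [hab])]
        exact zero_mem _
    · obtain ⟨a, b, hab, hne⟩ := Function.not_injective_iff.mp hi
      rw [det_zero_of_row_eq hne (by ext; simp [hab])]
      exact zero_mem _

/-- The Schur complement of the block `f × f` of `A`, multiplied by the determinant of the block. -/
def scaledSchurComplement {ι : Type*} {r : ℕ} (A : Matrix ι ι R) (f : Fin r → ι) :
    Matrix {a // a ∉ Set.range f} {a // a ∉ Set.range f} R :=
  (A.submatrix f f).det • A.submatrix (↑) (↑) -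
    A.submatrix (↑) f * (A.submatrix f f).adjugate * A.submatrix f (↑)

theorem scaledSchurComplement_map {S : Type*} [CommRing S] (g : R →+* S) {ι : Type*} {r : ℕ}
    (A : Matrix ι ι R) (f : Fin r → ι) :
    (A.map g).scaledSchurComplement f = (A.scaledSchurComplement f).map g := by
  have h : (A.submatrix f f).adjugate.map g = ((A.submatrix f f).map g).adjugate :=
    g.map_adjugate _
  have hd : g (A.submatrix f f).det = ((A.submatrix f f).map g).det := g.map_det _
  simp only [scaledSchurComplement, submatrix_map, ← h, ← hd, ← Matrix.map_mul]
  ext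
  simp only [sub_apply, smul_apply, map_apply, smul_eq_mul, map_sub, map_mul, submatrix_apply]

theorem transpose_scaledSchurComplement {ι : Type*} {r : ℕ} (A : Matrix ι ι R) (f : Fin r → ι) :
    (A.scaledSchurComplement f)ᵀ = Aᵀ.scaledSchurComplement f := by
  simp only [scaledSchurComplement, transpose_sub, transpose_smul, transpose_mul,
    transpose_submatrix, ← det_transpose (A.submatrix f f), adjugate_transpose, Matrix.mul_assoc]

theorem rank_eq_add_rank_scaledSchurComplement {K : Type*} [Field K] {ι : Type*} [Fintype ι]
    [DecidableEq ι] {r : ℕ} (A : Matrix ι ι K) {f : Fin r → ι} (hf : f.Injective)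
    (hdet : (A.submatrix f f).det ≠ 0) :
    A.rank = r + (A.scaledSchurComplement f).rank := by
  let e : Fin r ⊕ {a // a ∉ Set.range f} ≃ ι :=
    ((Equiv.ofInjective f hf).sumCongr (Equiv.refl _)).trans (Equiv.Set.sumCompl (Set.range f))
  have hA : A.submatrix e e = fromBlocks (A.submatrix f f) (A.submatrix f (↑))
      (A.submatrix (↑) f) (A.submatrix (↑) (↑)) := by
    ext (a | a) (b | b) <;> rfl
  rw [← A.rank_submatrix e e, hA, rank_fromBlocks_eq_add _ _ _ _ hdet, Fintype.card_fin]
  rfl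

theorem allMinorsIdeal_le_iff_scaledSchurComplement {ι : Type*} [Fintype ι] [DecidableEq ι]
    {r : ℕ} (A : Matrix ι ι R) {f : Fin r → ι} (hf : f.Injective) (q : Ideal R) [q.IsPrime]
    (hdet : (A.submatrix f f).det ∉ q) (s : ℕ) :
    A.allMinorsIdeal (r + s) ≤ q ↔ (A.scaledSchurComplement f).allMinorsIdeal s ≤ q := by
  have hd : ((A.map (algebraMap R q.ResidueField)).submatrix f f).det ≠ 0 := by
    rwa [submatrix_map, ← RingHom.mapMatrix_apply, ← RingHom.map_det, ne_eq,
      Ideal.algebraMap_residueField_eq_zero]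
  rw [allMinorsIdeal_le_iff_rank_lt, allMinorsIdeal_le_iff_rank_lt,
    rank_eq_add_rank_scaledSchurComplement _ hf hd, scaledSchurComplement_map]
  omega

theorem mem_minimalPrimes_scaledSchurComplement {ι : Type*} [Fintype ι] [DecidableEq ι]
    {r s : ℕ} {A : Matrix ι ι R} {f : Fin r → ι} (hf : f.Injective) {p : Ideal R}
    (hp : p ∈ (A.allMinorsIdeal (r + s)).minimalPrimes) (hdet : (A.submatrix f f).det ∉ p) :
    p ∈ ((A.scaledSchurComplement f).allMinorsIdeal s).minimalPrimes := by
  have := hp.1.1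
  refine ⟨⟨this, (A.allMinorsIdeal_le_iff_scaledSchurComplement hf p hdet s).mp hp.1.2⟩, ?_⟩
  rintro q ⟨hq, hIq⟩ hqp
  exact hp.2 ⟨hq, (A.allMinorsIdeal_le_iff_scaledSchurComplement hf q
    (fun h ↦ hdet (hqp h)) s).mpr hIq⟩ hqp

theorem height_le_of_mem_minimalPrimes_allMinorsIdeal_one [IsNoetherianRing R] {ι : Type*}
    [Fintype ι] {A : Matrix ι ι R} (hA : A.IsSymm) {p : Ideal R}
    (hp : p ∈ (A.allMinorsIdeal 1).minimalPrimes) :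
    p.height ≤ (Fintype.card ι + 1).choose 2 := by
  let g : Sym2 ι → R := Sym2.lift ⟨fun i j ↦ A i j, fun i j ↦ (hA.apply i j).symm⟩
  have h : A.allMinorsIdeal 1 = Ideal.span (Set.range g) := by
    apply le_antisymm
    · refine (A.allMinorsIdeal_le_iff 1 _).mpr fun i j ↦ Ideal.subset_span ⟨s(i 0, j 0), ?_⟩
      simp [g]
    · refine Ideal.span_le.mpr ?_
      rintro _ ⟨x, rfl⟩
      induction x with | _ i j => ?_
      exact Ideal.subset_span ⟨(fun _ ↦ i, fun _ ↦ j), by simp [g]⟩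
  rw [h] at hp
  classical
  refine (Ideal.height_le_card_of_mem_minimalPrimes_span (Set.finite_range g) hp).trans ?_
  rw [← Sym2.card, ← Nat.card_eq_fintype_card, ← Set.ncard_univ, ← Set.image_univ]
  exact_mod_cast Set.ncard_image_le Set.finite_univ

/-- Adding an indeterminate to the diagonal entry at `a` of a matrix. -/
noncomputable def addIndeterminate {ι : Type*} [DecidableEq ι] (A : Matrix ι ι R) (a : ι) :
    Matrix ι ι R[X] :=
  A.map C + single a a X

theorem isSymm_addIndeterminate {ι : Type*} [DecidableEq ι] {A : Matrix ι ι R} (hA : A.IsSymm)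
    (a : ι) : (A.addIndeterminate a).IsSymm := by
  rw [IsSymm, addIndeterminate, transpose_add, ← transpose_map, hA.eq, transpose_single]

theorem addIndeterminate_map_of_X_eq_zero {S : Type*} [CommRing S] {ι : Type*} [DecidableEq ι]
    (A : Matrix ι ι R) (a : ι) {f : R[X] →+* S} (hf : f X = 0) :
    (A.addIndeterminate a).map f = (A.map C).map f := by
  ext i j
  simp [addIndeterminate, single_apply, apply_ite f, hf]

theorem allMinorsIdeal_addIndeterminate_le_iff {ι : Type*} [DecidableEq ι] (A : Matrix ι ι R)
    (a : ι) (s : ℕ) {q : Ideal R[X]} (hq : X ∈ q) :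
    (A.addIndeterminate a).allMinorsIdeal s ≤ q ↔ A.allMinorsIdeal s ≤ q.comap C := by
  have hX : Ideal.Quotient.mk q X = 0 := Ideal.Quotient.eq_zero_iff_mem.mpr hq
  have key (J : Ideal R[X]) : J ≤ q ↔ J.map (Ideal.Quotient.mk q) ≤ ⊥ := by
    rw [Ideal.map_le_iff_le_comap, ← RingHom.ker_eq_comap_bot, Ideal.mk_ker]
  rw [← Ideal.map_le_iff_le_comap, key, key, map_allMinorsIdeal, map_allMinorsIdeal,
    map_allMinorsIdeal, addIndeterminate_map_of_X_eq_zero A a hX]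

theorem allMinorsIdeal_addIndeterminate_le_map {ι : Type*} [Fintype ι] [DecidableEq ι]
    {A : Matrix ι ι R} (a : ι) {s : ℕ} (hs : 2 ≤ s) {p : Ideal R} [p.IsPrime]
    (hAp : ∀ i j, A i j ∈ p) :
    (A.addIndeterminate a).allMinorsIdeal s ≤ p.map C := by
  rw [allMinorsIdeal_le_iff_rank_lt]
  set g := algebraMap R[X] (p.map C).ResidueField
  have h : (A.addIndeterminate a).map g = vecMulVec (Pi.single a (g X)) (Pi.single a 1) := by
    ext i j
    have h0 : g (C (A i j)) = 0 :=
      Ideal.algebraMap_residueField_eq_zero.mpr (Ideal.mem_map_of_mem C (hAp i j))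
    rw [map_apply, addIndeterminate, add_apply, map_add, map_apply, h0, zero_add,
      vecMulVec_apply, single_apply, Pi.single_apply, Pi.single_apply, apply_ite g, map_zero]
    by_cases hi : a = i <;> simp [eq_comm, hi]
  rw [h]
  exact (rank_vecMulVec_le _ _).trans_lt hs

theorem map_mem_minimalPrimes_addIndeterminate [IsNoetherianRing R] {ι : Type*} [Fintype ι]
    [DecidableEq ι] {A : Matrix ι ι R} (a : ι) {s : ℕ} (hs : 2 ≤ s) {p : Ideal R}
    (hp : p ∈ (A.allMinorsIdeal s).minimalPrimes) (hAp : ∀ i j, A i j ∈ p) :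
    p.map C ∈ ((A.addIndeterminate a).allMinorsIdeal s).minimalPrimes := by
  have := hp.1.1
  set M : Ideal R[X] := p.comap constantCoeff with hM
  have hXM : X ∈ M := by simp [hM]
  have hMC : M.comap C = p := by
    ext x
    simp [hM]
  have hle : p.map C ≤ M := by
    rw [Ideal.map_le_iff_le_comap, hMC]
  have hlt : p.map C < M := by
    refine lt_of_le_of_ne hle fun h ↦ ?_
    rw [← h, Ideal.mem_map_C_iff] at hXM
    exact this.ne_top ((Ideal.eq_top_iff_one p).mpr (by simpa using hXM 1))
  refine Ideal.mem_minimalPrimes_span_of_mem_minimalPrimes_span_insert hlt X _ ?_ _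
    (Ideal.span_le.mp (allMinorsIdeal_addIndeterminate_le_map a hs hAp))
    ((Set.subset_insert _ _).trans (Ideal.subset_span.trans Ideal.le_radical))
  rw [Ideal.span_insert]
  change M ∈ (_ ⊔ (A.addIndeterminate a).allMinorsIdeal s).minimalPrimes
  refine ⟨⟨inferInstance, sup_le ((Ideal.span_singleton_le_iff_mem _).mpr hXM) ?_⟩, ?_⟩
  · rw [allMinorsIdeal_addIndeterminate_le_iff A a s hXM, hMC]
    exact hp.1.2
  · rintro Q ⟨hQ, hIQ⟩ hQM
    have hXQ : X ∈ Q := (Ideal.span_singleton_le_iff_mem _).mp (le_sup_left.trans hIQ)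
    have hpQ : p ≤ Q.comap C := by
      refine hp.2 ⟨hQ.comap C, ?_⟩ ?_
      · rw [← allMinorsIdeal_addIndeterminate_le_iff A a s hXQ]
        exact le_sup_right.trans hIQ
      · exact (Ideal.comap_mono hQM).trans hMC.le
    intro g hg
    rw [← divX_mul_X_add g]
    exact add_mem (Q.mul_mem_left _ hXQ) (hpQ hg)

end Minors

end Matrix

theorem Ideal.height_le_height_map_C_s3 {R : Type*} [CommRing R] [IsNoetherianRing R] (p : Ideal R)
    [p.IsPrime] : p.height ≤ (p.map (C : R →+* R[X])).height := by
  have : (p.map (C : R →+* R[X])).LiesOver p := ⟨by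
    ext x
    simp [Ideal.mem_map_C_iff, Ideal.mem_comap, coeff_C, apply_ite]⟩
  rw [Ideal.height_eq_height_add_of_liesOver_of_hasGoingDown p (p.map C)]
  exact le_self_add

namespace Matrix

/-- Let `A` be a symmetric `n × n` matrix over a Noetherian ring. A minimal prime over the ideal of
`s`-minors of `A` has height at most `(k + 1).choose 2`, where `k = n - s + 1`.

The proof goes by induction on `s`. If the prime `p` does not contain all entries of `A`, then some
principal minor of size one or two is not in `p`, and one passes to the Schur complement of that
block. Otherwise an indeterminate is added to a diagonal entry, and `p` is replaced by its
extension to the polynomial ring. -/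
theorem height_le_choose_of_mem_minimalPrimes_allMinorsIdeal {R : Type*} [CommRing R]
    [IsNoetherianRing R] {ι : Type*} [Fintype ι] {A : Matrix ι ι R} (hA : A.IsSymm) {s k : ℕ}
    (hs : 1 ≤ s) (hk : Fintype.card ι + 1 = s + k) {p : Ideal R}
    (hp : p ∈ (A.allMinorsIdeal s).minimalPrimes) :
    p.height ≤ (k + 1).choose 2 := by
  classical
  induction s using Nat.strong_induction_on generalizing R ι with | _ s ih
  have pivot {S : Type _} [CommRing S] [IsNoetherianRing S] {B : Matrix ι ι S} (hB : B.IsSymm)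
      {P : Ideal S} (hP : P ∈ (B.allMinorsIdeal s).minimalPrimes) {r : ℕ} (hr : 0 < r)
      (hrs : r ≤ s) {f : Fin r → ι} (hf : f.Injective) (hdet : (B.submatrix f f).det ∉ P) :
      P.height ≤ (k + 1).choose 2 := by
    obtain ⟨t, rfl⟩ := Nat.exists_eq_add_of_le hrs
    rcases Nat.eq_zero_or_pos t with rfl | ht
    · exact absurd ((B.allMinorsIdeal_le_iff _ P).mp hP.1.2 f f) hdet
    refine ih t (by omega) (A := B.scaledSchurComplement f) ?_ ht ?_
      (mem_minimalPrimes_scaledSchurComplement hf hP hdet)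
    · rw [IsSymm, transpose_scaledSchurComplement, hB.eq]
    · have h1 : Fintype.card {a // a ∈ Set.range f} = r := by
        rw [← Fintype.card_congr (Equiv.ofInjective f hf), Fintype.card_fin]
      have h2 := Fintype.card_subtype_compl (· ∈ Set.range f)
      have h3 := Fintype.card_subtype_le (· ∈ Set.range f)
      omega
  rcases hs.eq_or_lt with rfl | hs2
  · have hcard : Fintype.card ι = k := by omega
    simpa [hcard] using height_le_of_mem_minimalPrimes_allMinorsIdeal_one hA hp
  by_cases hdiag : ∀ a, A a a ∈ p
  · have := hp.1.1
    by_cases hAp : ∀ a b, A a b ∈ p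
    · obtain ⟨a⟩ : Nonempty ι := Fintype.card_pos_iff.mp (by omega)
      refine p.height_le_height_map_C_s3.trans ?_
      refine pivot (isSymm_addIndeterminate hA a)
        (map_mem_minimalPrimes_addIndeterminate a hs2 hp hAp) one_pos hs (f := fun _ ↦ a)
        (Function.injective_of_subsingleton _) ?_
      rw [det_fin_one, Ideal.mem_map_C_iff]
      intro h
      refine this.ne_top ((Ideal.eq_top_iff_one p).mpr ?_)
      simpa [addIndeterminate, coeff_C] using h 1
    · push Not at hAp
      obtain ⟨a, b, hab⟩ := hAp
      have hne : a ≠ b := by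
        rintro rfl
        exact hab (hdiag a)
      refine pivot hA hp two_pos hs2 (f := ![a, b])
        (by simpa [Function.Injective, Fin.forall_fin_two] using ⟨hne, hne.symm⟩) fun h ↦ hab ?_
      rw [det_fin_two] at h
      have h' : A a a * A b b - A a b * A a b ∈ p := by
        simpa [hA.apply] using h
      have hsq : A a b * A a b ∈ p := by
        simpa using sub_mem (p.mul_mem_right (A b b) (hdiag a)) h'
      exact (or_self_iff).mp (this.mem_or_mem hsq)
  · push Not at hdiag
    obtain ⟨a, ha⟩ := hdiag
    exact pivot hA hp one_pos hs (f := fun _ ↦ a) (Function.injective_of_subsingleton _)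
      (by simpa [det_fin_one] using ha)

end Matrix

theorem idealHeight_eq_height {R : Type*} [CommRing R] (I : Ideal R) : idealHeight I = I.height := by
  have h (P : {J : Ideal R // J.IsPrime}) : Order.height P = P.1.height := by
    rw [← Order.height_orderIso (PrimeSpectrum.equivSubtype R).symm P,
      ← PrimeSpectrum.height_eq_orderHeight]
    rfl
  simp only [idealHeight, h]
  apply le_antisymm
  · rw [I.height_eq_inf_minimalPrimes]
    exact le_iInf₂ fun p hp ↦ iInf₂_le (⟨p, hp.1.1⟩ : {J : Ideal R // J.IsPrime}) hp.1.2
  · exact le_iInf₂ fun P hP ↦ Ideal.height_mono hP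

/-- Kutz's bound: if `A` is a symmetric `n × n` matrix over a Noetherian
commutative ring and the ideal of `s`-minors of `A` is proper, then its height
is at most `(n - s + 2) * (n - s + 1) / 2`. -/
theorem height_minorsIdeal_symmetric_le {R : Type*} [CommRing R] [IsNoetherianRing R]
    {n : ℕ} (A : Matrix (Fin n) (Fin n) R) (hA : A.transpose = A)
    (s : ℕ) (hs1 : 1 ≤ s) (hsn : s ≤ n) (hI : minorsIdeal A s ≠ ⊤) :
    idealHeight (minorsIdeal A s) ≤ (((n - s + 2) * (n - s + 1)) / 2 : ℕ) := by
  obtain ⟨k, rfl⟩ := Nat.exists_eq_add_of_le hsn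
  rw [Matrix.minorsIdeal_eq_allMinorsIdeal] at hI ⊢
  obtain ⟨p, hp⟩ := Ideal.nonempty_minimalPrimes hI
  have h := Matrix.height_le_choose_of_mem_minimalPrimes_allMinorsIdeal (k := k + 1) hA hs1
    (by rw [Fintype.card_fin, add_assoc]) hp
  rw [idealHeight_eq_height]
  refine (Ideal.height_mono hp.1.2).trans (h.trans_eq ?_)
  rw [Nat.choose_two_right, Nat.add_sub_cancel_left]
  rfl
end

section
/- (Reduction of units in the matrix.) Let R be a commutative ring and let A be an m×n matrix over R, with m, n ≥ 1, such that some entry of A is a unit of R. Then there exist an invertible m×m matrix P over R, an invertible n×n matrix Q over R, and an (m−1)×(n−1) matrix Ã over R, such that P·A·Q⁻¹ is the block matrix with top-left 1×1 block equal to 1, zero off-diagonal blocks, and bottom-right block Ã; moreover, for every t ≥ 1 the ideal of t-minors of A coincides with the ideal of (t−1)-minors of Ã: I_t(A) = I_{t−1}(Ã). -/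
section MinorsIdeal

variable {R : Type*} [CommRing R] {m n : ℕ}

theorem det_submatrix_mem_minorsIdeal (A : Matrix (Fin m) (Fin n) R) {t : ℕ}
    (i : Fin t → Fin m) (j : Fin t → Fin n) :
    (A.submatrix i j).det ∈ minorsIdeal A t := by
  by_cases hi : Function.Injective i
  · by_cases hj : Function.Injective j
    · have hi' : StrictMono (i ∘ Tuple.sort i) :=
        (Tuple.monotone_sort i).strictMono_of_injective (hi.comp (Tuple.sort i).injective)
      have hj' : StrictMono (j ∘ Tuple.sort j) :=
        (Tuple.monotone_sort j).strictMono_of_injective (hj.comp (Tuple.sort j).injective)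
      have key : A.submatrix i j =
          ((A.submatrix (i ∘ Tuple.sort i) (j ∘ Tuple.sort j)).submatrix
            (Tuple.sort i).symm id).submatrix id (Tuple.sort j).symm := by
        ext a b
        simp
      rw [key, Matrix.det_permute', Matrix.det_permute]
      exact Ideal.mul_mem_left _ _ (Ideal.mul_mem_left _ _
        (Ideal.subset_span ⟨_, _, hi', hj', rfl⟩))
    · simp only [Function.Injective, not_forall] at hj
      obtain ⟨a, b, hab, hne⟩ := hj
      rw [Matrix.det_zero_of_column_eq hne fun k => by simp [hab]]
      exact zero_mem _
  · simp only [Function.Injective, not_forall] at hi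
    obtain ⟨a, b, hab, hne⟩ := hi
    rw [Matrix.det_zero_of_row_eq hne (by ext k; simp [hab])]
    exact zero_mem _

theorem minorsIdeal_le_iff (A : Matrix (Fin m) (Fin n) R) {t : ℕ} {I : Ideal R} :
    minorsIdeal A t ≤ I ↔ ∀ (i : Fin t → Fin m) (j : Fin t → Fin n),
      (A.submatrix i j).det ∈ I := by
  refine ⟨fun h i j => h (det_submatrix_mem_minorsIdeal A i j), fun h => ?_⟩
  refine Ideal.span_le.2 ?_
  rintro _ ⟨i, j, -, -, rfl⟩
  exact h i j

theorem minorsIdeal_mul_left_le {l : ℕ} (P : Matrix (Fin l) (Fin m) R)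
    (A : Matrix (Fin m) (Fin n) R) (t : ℕ) :
    minorsIdeal (P * A) t ≤ minorsIdeal A t := by
  refine (minorsIdeal_le_iff _).2 fun i j => ?_
  have rows : (P * A).submatrix i j = fun a => ∑ k, P (i a) k • fun b => A k (j b) := by
    ext a b
    simp [Matrix.mul_apply]
  have expand : ((P * A).submatrix i j).det =
      ∑ r : Fin t → Fin m, (∏ a, P (i a) (r a)) * (A.submatrix r j).det := by
    rw [rows]
    refine (Matrix.detRowAlternating.toMultilinearMap.map_sum
      fun a k => P (i a) k • fun b => A k (j b)).trans (Finset.sum_congr rfl fun r _ => ?_)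
    exact Matrix.detRowAlternating.toMultilinearMap.map_smul_univ _ _
  rw [expand]
  exact Ideal.sum_mem _ fun r _ =>
    Ideal.mul_mem_left _ _ (det_submatrix_mem_minorsIdeal A r j)

theorem minorsIdeal_transpose (A : Matrix (Fin m) (Fin n) R) (t : ℕ) :
    minorsIdeal A.transpose t = minorsIdeal A t := by
  refine le_antisymm ((minorsIdeal_le_iff _).2 fun i j => ?_)
    ((minorsIdeal_le_iff _).2 fun i j => ?_)
  · rw [← Matrix.transpose_submatrix, Matrix.det_transpose]
    exact det_submatrix_mem_minorsIdeal A j i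
  · rw [← Matrix.det_transpose, Matrix.transpose_submatrix]
    exact det_submatrix_mem_minorsIdeal A.transpose j i

theorem minorsIdeal_mul_right_le {l : ℕ} (A : Matrix (Fin m) (Fin n) R)
    (Q : Matrix (Fin n) (Fin l) R) (t : ℕ) :
    minorsIdeal (A * Q) t ≤ minorsIdeal A t := by
  rw [← minorsIdeal_transpose, Matrix.transpose_mul, ← minorsIdeal_transpose A]
  exact minorsIdeal_mul_left_le _ _ t

theorem minorsIdeal_mul_mul_of_isUnit {U : Matrix (Fin m) (Fin m) R}
    {V : Matrix (Fin n) (Fin n) R} (hU : IsUnit U) (hV : IsUnit V)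
    (A : Matrix (Fin m) (Fin n) R) (t : ℕ) :
    minorsIdeal (U * A * V) t = minorsIdeal A t := by
  refine le_antisymm
    ((minorsIdeal_mul_right_le _ _ t).trans (minorsIdeal_mul_left_le _ _ t)) ?_
  have key : U⁻¹ * (U * A * V) * V⁻¹ = A := by
    rw [Matrix.isUnit_iff_isUnit_det] at hU hV
    rw [Matrix.mul_assoc U, Matrix.nonsing_inv_mul_cancel_left _ _ hU,
      Matrix.mul_nonsing_inv_cancel_right _ _ hV]
  calc minorsIdeal A t = minorsIdeal (U⁻¹ * (U * A * V) * V⁻¹) t := by rw [key]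
    _ ≤ minorsIdeal (U * A * V) t :=
      (minorsIdeal_mul_right_le _ _ t).trans (minorsIdeal_mul_left_le _ _ t)

theorem minorsIdeal_fromBlocks_one (A : Matrix (Fin m) (Fin n) R) (t : ℕ) :
    minorsIdeal (Matrix.reindex finSumFinEquiv finSumFinEquiv
      (Matrix.fromBlocks (1 : Matrix (Fin 1) (Fin 1) R) 0 0 A)) (t + 1) = minorsIdeal A t := by
  set B := Matrix.reindex finSumFinEquiv finSumFinEquiv
    (Matrix.fromBlocks (1 : Matrix (Fin 1) (Fin 1) R) 0 0 A) with hB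
  have pos_row {p : ℕ} (k : Fin (1 + p)) (hk : 0 < k) : ∃ l, k = Fin.natAdd 1 l := by
    refine ⟨⟨k - 1, ?_⟩, Fin.ext ?_⟩ <;> have := Fin.lt_def.1 hk <;> simp at this ⊢ <;> omega
  apply le_antisymm
  · refine Ideal.span_le.2 ?_
    rintro _ ⟨i, j, hi, -, rfl⟩
    have rows : ∀ a : Fin t, ∃ l, i a.succ = Fin.natAdd 1 l := fun a =>
      pos_row _ ((Fin.zero_le (i 0)).trans_lt (hi a.succ_pos))
    choose r hr using rows
    rw [SetLike.mem_coe, Matrix.det_succ_row_zero]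
    refine Ideal.sum_mem _ fun k _ => Ideal.mul_mem_left _ _ ?_
    by_cases hc : ∀ b : Fin t, ∃ l, j (k.succAbove b) = Fin.natAdd 1 l
    · choose c hc using hc
      convert det_submatrix_mem_minorsIdeal A r c using 2
      ext a b
      simp [hB, hr, hc]
    · obtain ⟨b, hb⟩ := not_forall.1 hc
      have hb0 : j (k.succAbove b) = Fin.castAdd n 0 := by
        by_contra hne
        refine hb (pos_row _ (Fin.pos_iff_ne_zero.2 fun h => hne (h.trans (Fin.ext ?_))))
        simp
      rw [Matrix.det_eq_zero_of_column_eq_zero b fun a => by simp [hB, hr, hb0]]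
      exact zero_mem _
  · refine (minorsIdeal_le_iff _).2 fun i j => ?_
    convert det_submatrix_mem_minorsIdeal B
      (Fin.cons (Fin.castAdd m 0) fun a => Fin.natAdd 1 (i a))
      (Fin.cons (Fin.castAdd n 0) fun b => Fin.natAdd 1 (j b)) using 1
    rw [Matrix.det_succ_row_zero, Fin.sum_univ_succ, Finset.sum_eq_zero]
    · have sub : (B.submatrix (Fin.cons (Fin.castAdd m 0) fun a => Fin.natAdd 1 (i a))
          (Fin.cons (Fin.castAdd n 0) fun b => Fin.natAdd 1 (j b))).submatrix Fin.succ
            (Fin.succAbove 0) = A.submatrix i j := by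
        ext a b
        simp [hB]
      rw [sub]
      simp [hB]
    · intro k _
      simp [hB]

end MinorsIdeal

theorem exists_eq_mul_fromBlocks_one_mul {R : Type*} [CommRing R] {m n : ℕ}
    (A : Matrix (Fin (1 + m)) (Fin (1 + n)) R)
    (h : ∃ (i : Fin (1 + m)) (j : Fin (1 + n)), IsUnit (A i j)) :
    ∃ (U : Matrix (Fin (1 + m)) (Fin (1 + m)) R)
      (V : Matrix (Fin (1 + n)) (Fin (1 + n)) R)
      (A' : Matrix (Fin m) (Fin n) R),
      IsUnit U ∧ IsUnit V ∧
      A = U * Matrix.reindex finSumFinEquiv finSumFinEquiv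
          (Matrix.fromBlocks (1 : Matrix (Fin 1) (Fin 1) R) 0 0 A') * V := by
  obtain ⟨i, j, hij⟩ := h
  let e : Fin 1 ⊕ Fin m ≃ Fin (1 + m) :=
    finSumFinEquiv.trans (Equiv.swap (finSumFinEquiv (Sum.inl 0)) i)
  let f : Fin 1 ⊕ Fin n ≃ Fin (1 + n) :=
    finSumFinEquiv.trans (Equiv.swap (finSumFinEquiv (Sum.inl 0)) j)
  let M := A.submatrix e f
  have hM : IsUnit M.toBlocks₁₁.det := by
    simpa [M, e, f, Matrix.toBlocks₁₁] using hij
  let L := Matrix.fromBlocks M.toBlocks₁₁ 0 M.toBlocks₂₁ (1 : Matrix (Fin m) (Fin m) R)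
  let N := Matrix.fromBlocks (1 : Matrix (Fin 1) (Fin 1) R) (M.toBlocks₁₁⁻¹ * M.toBlocks₁₂) 0
    (1 : Matrix (Fin n) (Fin n) R)
  let A' := M.toBlocks₂₂ - M.toBlocks₂₁ * (M.toBlocks₁₁⁻¹ * M.toBlocks₁₂)
  have hL : IsUnit L := by
    simpa [L, Matrix.isUnit_iff_isUnit_det] using hM
  have hN : IsUnit N := by
    simp [N, Matrix.isUnit_iff_isUnit_det]
  have factor : M = L * Matrix.fromBlocks (1 : Matrix (Fin 1) (Fin 1) R) 0 0 A' * N := by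
    conv_lhs => rw [← Matrix.fromBlocks_toBlocks M]
    simp [L, N, A', Matrix.fromBlocks_multiply, Matrix.mul_nonsing_inv_cancel_left _ _ hM,
      -Matrix.inv_subsingleton]
  refine ⟨L.submatrix e.symm finSumFinEquiv.symm, N.submatrix finSumFinEquiv.symm f.symm, A',
    (Matrix.isUnit_submatrix_equiv _ _).2 hL, (Matrix.isUnit_submatrix_equiv _ _).2 hN, ?_⟩
  rw [Matrix.reindex_apply, Matrix.submatrix_mul_equiv, Matrix.submatrix_mul_equiv, ← factor]
  ext a b
  simp [M]

/-- Reduction of units in the matrix: if some entry of the `(1+m) × (1+n)` matrix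
`A` is a unit, then there are invertible matrices `P`, `Q` and an `m × n` matrix
`A'` such that `P · A · Q⁻¹` is the block matrix `[[1, 0], [0, A']]`, and for every
`t ≥ 1` the ideal of `t`-minors of `A` equals the ideal of `(t-1)`-minors of `A'`. -/
theorem reduction_of_units {R : Type*} [CommRing R] {m n : ℕ}
    (A : Matrix (Fin (1 + m)) (Fin (1 + n)) R)
    (h : ∃ (i : Fin (1 + m)) (j : Fin (1 + n)), IsUnit (A i j)) :
    ∃ (P : Matrix (Fin (1 + m)) (Fin (1 + m)) R)
      (Q : Matrix (Fin (1 + n)) (Fin (1 + n)) R)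
      (A' : Matrix (Fin m) (Fin n) R),
      IsUnit P ∧ IsUnit Q ∧
      P * A * Q⁻¹ =
        Matrix.reindex finSumFinEquiv finSumFinEquiv
          (Matrix.fromBlocks (1 : Matrix (Fin 1) (Fin 1) R) 0 0 A') ∧
      ∀ t : ℕ, 1 ≤ t → minorsIdeal A t = minorsIdeal A' (t - 1) := by
  obtain ⟨U, V, A', hU, hV, hA⟩ := exists_eq_mul_fromBlocks_one_mul A h
  refine ⟨U⁻¹, V, A', (Matrix.isUnit_nonsing_inv_iff).2 hU, hV, ?_, fun t ht => ?_⟩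
  · rw [Matrix.isUnit_iff_isUnit_det] at hU hV
    rw [hA, Matrix.mul_assoc U, Matrix.nonsing_inv_mul_cancel_left _ _ hU,
      Matrix.mul_nonsing_inv_cancel_right _ _ hV]
  · obtain ⟨t, rfl⟩ := Nat.exists_eq_add_of_le' ht
    rw [hA, minorsIdeal_mul_mul_of_isUnit hU hV, minorsIdeal_fromBlocks_one,
      Nat.add_sub_cancel]
end

section
/- Let K be a field and let A be an m×n matrix over K. For every natural number s, the rank of A is strictly less than s if and only if every s-minor of A vanishes, i.e. det(A.submatrix i j) = 0 for all strictly monotone maps i : Fin s → Fin m and j : Fin s → Fin n. (This identifies the generic determinantal variety M^s_{m,n}, the vanishing locus of the ideal of s-minors of the generic matrix, with the set of m×n matrices of rank less than s.) -/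
/-- A finite family whose span has dimension at least `s` has a linearly independent subfamily of
length `s`, indexed in increasing order. -/
theorem exists_strictMono_linearIndependent_of_le_finrank_span {K V ι : Type*} [Field K]
    [AddCommGroup V] [Module K V] [Fintype ι] [LinearOrder ι] (v : ι → V) {s : ℕ}
    (hs : s ≤ Module.finrank K (Submodule.span K (Set.range v))) :
    ∃ j : Fin s → ι, StrictMono j ∧ LinearIndependent K (v ∘ j) := by
  classical
  obtain ⟨κ, a, ha, hspan, hli⟩ := exists_linearIndependent' K v
  have : Fintype κ := Fintype.ofInjective a ha
  rw [← hspan, finrank_span_eq_card hli] at hs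
  obtain ⟨t, -, ht⟩ := Finset.exists_subset_card_eq (s := (Finset.univ : Finset κ)) hs
  have hcard : (t.map ⟨a, ha⟩).card = s := by rw [Finset.card_map, ht]
  have hmem (x : Fin s) : ∃ k, a k = (t.map ⟨a, ha⟩).orderEmbOfFin hcard x := by
    obtain ⟨k, -, hk⟩ := Finset.mem_map.1 (Finset.orderEmbOfFin_mem _ hcard x)
    exact ⟨k, hk⟩
  choose b hb using hmem
  refine ⟨_, ((t.map ⟨a, ha⟩).orderEmbOfFin hcard).strictMono, ?_⟩
  have hb_inj : Function.Injective b := fun x y hxy =>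
    ((t.map ⟨a, ha⟩).orderEmbOfFin hcard).injective (by rw [← hb, ← hb, hxy])
  have h := hli.comp b hb_inj
  rwa [Function.comp_assoc, show a ∘ b = _ from funext hb] at h

/-- A matrix over a field has rank strictly less than `s` if and only if all of
its `s`-minors vanish. This identifies the generic determinantal variety
`M^s_{m,n}` with the set of `m × n` matrices of rank less than `s`. -/
theorem rank_lt_iff_forall_minor_eq_zero {K : Type*} [Field K] {m n : ℕ}
    (A : Matrix (Fin m) (Fin n) K) (s : ℕ) :
    A.rank < s ↔ ∀ (i : Fin s → Fin m) (j : Fin s → Fin n),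
      StrictMono i → StrictMono j → (A.submatrix i j).det = 0 := by
  constructor
  · intro h i j _ _
    by_contra hdet
    have hle := A.rank_submatrix_le i j
    rw [Matrix.rank_of_det_ne_zero hdet, Fintype.card_fin] at hle
    omega
  · intro h
    by_contra! hs
    rw [Matrix.rank_eq_finrank_span_row] at hs
    obtain ⟨i, hi, hrow⟩ := exists_strictMono_linearIndependent_of_le_finrank_span A.row hs
    have hrank : (A.submatrix i id).rank = s := by
      simpa using LinearIndependent.rank_matrix (M := A.submatrix i id) hrow
    rw [Matrix.rank_eq_finrank_span_cols] at hrank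
    obtain ⟨j, hj, hcol⟩ := exists_strictMono_linearIndependent_of_le_finrank_span _ hrank.ge
    have hunit : IsUnit (A.submatrix i j) := Matrix.linearIndependent_cols_iff_isUnit.1 hcol
    exact ((Matrix.isUnit_iff_isUnit_det _).1 hunit).ne_zero (h i j hi hj)
end
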